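/- For every integer m ≥ 1 and every n ≥ 0, the following equality of rational numbers holds: s_n^{(m)}/(n!)^2 = ∑_{b=(b_1,…,b_m)∈ℕ^m, b_1+⋯+b_m=n} ( ∏_{1≤i<j≤m} (b_i − i − b_j + j) ) / ( ∏_{i=1}^m b_i!·(b_i − i + m)! ), where s_n^{(m)} denotes the number of permutations in S_n^{(m)}. (Here b_i − i + m ≥ 0 for all i, so all factorials are factorials of natural numbers, while the factors b_i − i − b_j + j are integers.) -/

import Mathlib

open scoped Classical

noncomputable section

/-- `f` has an ascending subsequence of length `k`. -/
def HasAscSeq {n : ℕ} (f : Fin n → Fin n) (k : ℕ) : Prop :=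
  ∃ s : Fin k → Fin n, StrictMono s ∧ StrictMono fun a => f (s a)

/-- The number of permutations of `{1,…,n}` with no ascending subsequence of
length `m+1`, i.e. the cardinality of `S_n^{(m)}`. -/
def permCount (m n : ℕ) : ℕ :=
  Nat.card {τ : Equiv.Perm (Fin n) // ¬ HasAscSeq (⇑τ) (m + 1)}

/-- The number of occurrences of the letter `x` among the first `t` letters of the word `f`. -/
def letterCount {n m : ℕ} (f : Fin n → Fin m) (x : Fin m) (t : ℕ) : ℕ :=
  (Finset.univ.filter fun q : Fin n => q.val < t ∧ f q = x).card

section LetterCount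

variable {n m : ℕ} (f : Fin n → Fin m) (x : Fin m)

lemma letterCount_zero : letterCount f x 0 = 0 := by
  simp [letterCount]

lemma letterCount_mono {s t : ℕ} (h : s ≤ t) : letterCount f x s ≤ letterCount f x t := by
  apply Finset.card_le_card
  intro q
  simp only [Finset.mem_filter, Finset.mem_univ, true_and]
  exact fun hq => ⟨hq.1.trans_le h, hq.2⟩

lemma letterCount_succ (p : Fin n) :
    letterCount f x (p + 1) = letterCount f x p + if f p = x then 1 else 0 := by
  unfold letterCount
  split_ifs with h
  · rw [← Finset.card_insert_of_notMem (a := p) (by simp)]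
    congr 1
    ext q
    simp only [Finset.mem_filter, Finset.mem_univ, true_and, Finset.mem_insert, Fin.ext_iff]
    constructor
    · rintro ⟨h1, h2⟩
      by_cases hq : q.val = p.val
      · exact Or.inl hq
      · exact Or.inr ⟨by omega, h2⟩
    · rintro (h1 | h1)
      · exact ⟨by omega, by rw [Fin.ext h1, h]⟩
      · exact ⟨by omega, h1.2⟩
  · rw [add_zero]
    congr 1
    ext q
    simp only [Finset.mem_filter, Finset.mem_univ, true_and]
    constructor
    · rintro ⟨h1, h2⟩
      refine ⟨lt_of_le_of_ne (by omega) fun hq => h ?_, h2⟩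
      rwa [← Fin.ext hq]
    · exact fun h1 => ⟨by omega, h1.2⟩

lemma letterCount_lt {p : Fin n} {t : ℕ} (h : p.val < t) (hp : f p = x) :
    letterCount f x p < letterCount f x t := by
  have h1 := letterCount_succ f x p
  have h2 := letterCount_mono f x (Nat.succ_le_of_lt h)
  rw [if_pos hp] at h1
  simp only [Nat.succ_eq_add_one] at h2
  omega

lemma exists_letterCount_eq {l T : ℕ} (hT : T ≤ n) (h : l ≤ letterCount f x T) :
    ∃ t ≤ T, letterCount f x t = l := by
  induction T with
  | zero => exact ⟨0, le_rfl, by rw [letterCount_zero] at h ⊢; omega⟩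
  | succ T ih =>
    by_cases hl : l ≤ letterCount f x T
    · obtain ⟨t, ht, h2⟩ := ih (by omega) hl
      exact ⟨t, by omega, h2⟩
    · refine ⟨T + 1, le_rfl, ?_⟩
      have h1 := letterCount_succ f x ⟨T, hT⟩
      simp only at h1
      split_ifs at h1 <;> omega

lemma exists_letter_of_letterCount_eq_succ {k T : ℕ} (hT : T ≤ n)
    (h : letterCount f x T = k + 1) :
    ∃ p : Fin n, p.val < T ∧ f p = x ∧ letterCount f x p = k := by
  induction T with
  | zero => rw [letterCount_zero] at h; omega
  | succ T ih =>
    have h1 := letterCount_succ f x ⟨T, hT⟩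
    simp only at h1
    split_ifs at h1 with hx
    · exact ⟨⟨T, hT⟩, by simp, hx, by simp only; omega⟩
    · obtain ⟨p, hp, h2⟩ := ih (by omega) (by omega)
      exact ⟨p, by omega, h2⟩

lemma sum_letterCount : ∑ y, letterCount f y n = n := by
  have := Finset.card_eq_sum_card_fiberwise (f := f) (s := Finset.univ) (t := Finset.univ)
    (fun _ _ => Finset.mem_coe.mpr (Finset.mem_univ _))
  simp only [Finset.card_univ, Fintype.card_fin] at this
  simpa [letterCount] using this.symm

lemma letterCount_congr {f g : Fin n → Fin m} {t : ℕ} (h : ∀ q : Fin n, q.val < t → f q = g q) :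
    letterCount f x t = letterCount g x t := by
  unfold letterCount
  congr 1
  ext q
  simp only [Finset.mem_filter, Finset.mem_univ, true_and]
  exact and_congr_right fun hq => by rw [h q hq]

end LetterCount

/-- Exchange the letters `i` and `j` in the word `f`, from position `t` on. -/
def flipTail {n m : ℕ} (i j : Fin m) (t : ℕ) (f : Fin n → Fin m) : Fin n → Fin m :=
  fun q => if q.val < t then f q else Equiv.swap i j (f q)

section FlipTail

variable {n m : ℕ} (i j : Fin m) (t : ℕ) (f : Fin n → Fin m) (x : Fin m)

lemma flipTail_apply_of_lt {q : Fin n} (h : q.val < t) : flipTail i j t f q = f q := if_pos h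

lemma flipTail_flipTail : flipTail i j t (flipTail i j t f) = f := by
  ext q
  unfold flipTail
  split_ifs <;> simp

lemma letterCount_flipTail_of_le {s : ℕ} (h : s ≤ t) :
    letterCount (flipTail i j t f) x s = letterCount f x s :=
  letterCount_congr x fun _ hq => flipTail_apply_of_lt i j t f (hq.trans_le h)

lemma letterCount_flipTail_of_ne (hi : x ≠ i) (hj : x ≠ j) (s : ℕ) :
    letterCount (flipTail i j t f) x s = letterCount f x s := by
  unfold letterCount
  congr 1
  ext q
  simp only [Finset.mem_filter, Finset.mem_univ, true_and]
  refine and_congr_right fun _ => ?_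
  unfold flipTail
  split_ifs
  · rfl
  · rw [Equiv.swap_apply_eq_iff, Equiv.swap_apply_of_ne_of_ne hi hj]

lemma letterCount_flipTail_add {s : ℕ} (hts : t ≤ s) (hs : s ≤ n) :
    letterCount (flipTail i j t f) x s + letterCount f (Equiv.swap i j x) t =
      letterCount f x t + letterCount f (Equiv.swap i j x) s := by
  induction s, hts using Nat.le_induction with
  | base => rw [letterCount_flipTail_of_le i j t f x le_rfl]
  | succ s hts ih =>
    have h1 := letterCount_succ (flipTail i j t f) x ⟨s, hs⟩
    have h2 := letterCount_succ f (Equiv.swap i j x) ⟨s, hs⟩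
    have h3 : flipTail i j t f ⟨s, hs⟩ = x ↔ f ⟨s, hs⟩ = Equiv.swap i j x := by
      unfold flipTail
      rw [if_neg (by simpa using hts), Equiv.swap_apply_eq_iff]
    simp only [h3] at h1 h2
    have := ih (by omega)
    omega

end FlipTail

/-- At position `p` of the word `a`, carrying the letter `i + 1`, the ballot-type comparison of the
occurrences of `i` and `i + 1` in `a` with those in `c` fails, as witnessed by the prefix of `c` of
length `t`. -/
def BallotFailure {n m : ℕ} (a c : Fin n → Fin m) (p : Fin n) (t : ℕ) (i : Fin m) : Prop :=
  i.val + 1 = (a p).val ∧ t ≤ n ∧ letterCount c i t = letterCount a i p ∧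
    letterCount c (a p) t ≤ letterCount a (a p) p

/-- The ballot failure with the smallest position, and with the shortest witness there. -/
def FirstFailure {n m : ℕ} (a c : Fin n → Fin m) (p : Fin n) (t : ℕ) (i : Fin m) : Prop :=
  BallotFailure a c p t i ∧ (∀ p' < p, ∀ t' i', ¬ BallotFailure a c p' t' i') ∧
    ∀ t' < t, ¬ BallotFailure a c p t' i

section Failure

variable {n m : ℕ} {a c : Fin n → Fin m} {p : Fin n} {t : ℕ} {i : Fin m}

lemma FirstFailure.unique {p' : Fin n} {t' : ℕ} {i' : Fin m} (h : FirstFailure a c p t i)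
    (h' : FirstFailure a c p' t' i') : p = p' ∧ t = t' ∧ i = i' := by
  have hp : p = p' := by
    rcases lt_trichotomy p p' with hl | hl | hl
    · exact absurd h.1 (h'.2.1 p hl t i)
    · exact hl
    · exact absurd h'.1 (h.2.1 p' hl t' i')
  subst hp
  have hi : i = i' := Fin.ext (by have := h.1.1; have := h'.1.1; omega)
  subst hi
  refine ⟨rfl, ?_, rfl⟩
  rcases lt_trichotomy t t' with hl | hl | hl
  · exact absurd h.1 (h'.2.2 t hl)
  · exact hl
  · exact absurd h'.1 (h.2.2 t' hl)

lemma BallotFailure.exists_firstFailure (h : BallotFailure a c p t i) :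
    ∃ p t i, FirstFailure a c p t i := by
  induction p using WellFoundedLT.induction generalizing t i with
  | ind p ih =>
    by_cases hp : ∃ p' < p, ∃ t' i', BallotFailure a c p' t' i'
    · obtain ⟨p', hlt, t', i', h'⟩ := hp
      exact ih p' hlt h'
    · push Not at hp
      have hex : ∃ t, BallotFailure a c p t i := ⟨t, h⟩
      exact ⟨p, Nat.find hex, i, Nat.find_spec hex, hp, fun t' ht' => Nat.find_min hex ht'⟩

lemma FirstFailure.letterCount_eq (h : FirstFailure a c p t i) :
    letterCount c (a p) t = letterCount a (a p) p := by
  obtain ⟨⟨h1, h2, h3, h4⟩, h5, -⟩ := h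
  by_contra hne
  obtain ⟨p', hp', hap', hk⟩ := exists_letter_of_letterCount_eq_succ a (a p)
    (k := letterCount a (a p) p - 1) p.2.le (by omega)
  obtain ⟨t', ht', h6⟩ := exists_letterCount_eq c i (l := letterCount a i p') h2
    (by rw [h3]; exact letterCount_mono a i hp'.le)
  refine h5 p' hp' t' i ⟨by rw [hap', h1], by omega, h6, ?_⟩
  rw [hap', hk]
  have := letterCount_mono c (a p) ht'
  omega

lemma ballotFailure_flipTail_iff {j i' : Fin m} {p' : Fin n} {t' : ℕ} (hp : p' ≤ p)
    (ht : t' ≤ t) :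
    BallotFailure (flipTail i j (p + 1) a) (flipTail i j t c) p' t' i' ↔
      BallotFailure a c p' t' i' := by
  have hp' : p'.val ≤ p.val := hp
  unfold BallotFailure
  rw [flipTail_apply_of_lt i j _ a (show p'.val < p.val + 1 by omega),
    letterCount_flipTail_of_le i j _ _ _ ht, letterCount_flipTail_of_le i j _ _ _ ht,
    letterCount_flipTail_of_le i j _ _ _ (show p'.val ≤ p.val + 1 by omega),
    letterCount_flipTail_of_le i j _ _ _ (show p'.val ≤ p.val + 1 by omega)]

lemma BallotFailure.exists_flipTail {i' j : Fin m} {p' : Fin n} {t' : ℕ}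
    (h : BallotFailure a c p' t' i') (hp : p' < p) (hj : i.val + 1 = j.val) (ht : t ≤ n)
    (hci : letterCount c i t = letterCount a i p) (hcj : letterCount c j t = letterCount a j p) :
    ∃ t'', BallotFailure (flipTail i j (p + 1) a) (flipTail i j t c) p' t'' i' := by
  have hp' : p'.val < p.val := hp
  rcases le_or_gt t' t with htt | htt
  · exact ⟨t', (ballotFailure_flipTail_iff hp.le htt).mpr h⟩
  obtain ⟨h1, h2, h3, h4⟩ := h
  by_cases hi' : i' = i ∨ i' = j
  · refine ⟨t, (ballotFailure_flipTail_iff hp.le le_rfl).mpr ⟨h1, ht, ?_, ?_⟩⟩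
    · have e1 : letterCount c i' t = letterCount a i' p := by
        rcases hi' with rfl | rfl <;> assumption
      have e2 := letterCount_mono a i' hp'.le
      have e3 := letterCount_mono c i' htt.le
      omega
    · exact (letterCount_mono c _ htt.le).trans h4
  · push Not at hi'
    by_cases hpi : a p' = i
    · have e1 := letterCount_lt a i hp' hpi
      have e2 := letterCount_mono c i htt.le
      rw [hpi] at h4
      omega
    · have hpj : a p' ≠ j := fun e => hi'.1 (Fin.ext (by rw [e] at h1; omega))
      refine ⟨t', ?_⟩
      unfold BallotFailure
      rw [flipTail_apply_of_lt i j _ a (show p'.val < p.val + 1 by omega),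
        letterCount_flipTail_of_ne i j _ _ _ hi'.1 hi'.2,
        letterCount_flipTail_of_ne i j _ _ _ hi'.1 hi'.2,
        letterCount_flipTail_of_ne i j _ _ _ hpi hpj,
        letterCount_flipTail_of_ne i j _ _ _ hpi hpj]
      exact ⟨h1, h2, h3, h4⟩

lemma FirstFailure.flipTail (h : FirstFailure a c p t i) :
    FirstFailure (flipTail i (a p) (p + 1) a) (flipTail i (a p) t c) p t i := by
  have heq := h.letterCount_eq
  obtain ⟨h0, h1, h2⟩ := h
  refine ⟨(ballotFailure_flipTail_iff le_rfl le_rfl).mpr h0, fun p' hp' t' i' hf => ?_,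
    fun t' ht' hf => h2 t' ht' ((ballotFailure_flipTail_iff le_rfl ht'.le).mp hf)⟩
  have hp : p'.val < p.val := hp'
  obtain ⟨t'', ht''⟩ := hf.exists_flipTail (i := i) (j := a p) (t := t) hp' h0.1 h0.2.1
    (by rw [letterCount_flipTail_of_le _ _ _ _ _ le_rfl,
      letterCount_flipTail_of_le _ _ _ _ _ (Nat.le_succ _), h0.2.2.1])
    (by rw [letterCount_flipTail_of_le _ _ _ _ _ le_rfl,
      letterCount_flipTail_of_le _ _ _ _ _ (Nat.le_succ _), heq])
  rw [flipTail_flipTail, flipTail_flipTail] at ht''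
  exact h1 p' hp' t'' i' ht''

end Failure

/-- The content of the word `c` is obtained from the content of `a` by the dot action of `π`. -/
def ContentRel {n m : ℕ} (a c : Fin n → Fin m) (π : Equiv.Perm (Fin m)) : Prop :=
  ∀ x : Fin m, letterCount c x n + x.val = letterCount a x n + (π x).val

section ContentRel

variable {n m : ℕ} {a c : Fin n → Fin m} {π : Equiv.Perm (Fin m)}

lemma ContentRel.flipTail {p : Fin n} {t : ℕ} {i : Fin m} (h : ContentRel a c π)
    (hf : FirstFailure a c p t i) :
    ContentRel (flipTail i (a p) (p + 1) a) (flipTail i (a p) t c)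
      (π * Equiv.swap i (a p)) := by
  intro x
  have heq := hf.letterCount_eq
  obtain ⟨⟨h1, h2, h3, -⟩, -⟩ := hf
  have e1 := letterCount_flipTail_add i (a p) (p + 1) a x p.2 le_rfl
  have e2 := letterCount_flipTail_add i (a p) t c x h2 le_rfl
  have e3 := h (Equiv.swap i (a p) x)
  have hne : i ≠ a p := fun e => by rw [← e] at h1; omega
  have si := letterCount_succ a i p
  have sj := letterCount_succ a (a p) p
  rw [if_neg hne.symm] at si
  rw [if_pos rfl] at sj
  rw [Equiv.Perm.mul_apply]
  by_cases hxi : x = i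
  · subst hxi
    rw [Equiv.swap_apply_left] at *
    omega
  by_cases hxj : x = a p
  · subst hxj
    rw [Equiv.swap_apply_right] at *
    omega
  · rw [Equiv.swap_apply_of_ne_of_ne hxi hxj] at *
    omega

lemma ContentRel.exists_ballotFailure (h : ContentRel a c π) (hπ : π ≠ 1) :
    ∃ p t i, BallotFailure a c p t i := by
  have hex : ∃ k, ∃ hk : k < m, (π ⟨k, hk⟩).val < k := by
    by_contra hno
    push Not at hno
    apply hπ
    have hle : ∀ x ∈ (Finset.univ : Finset (Fin m)), x.val ≤ (π x).val := fun x _ => hno x x.2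
    have := (Finset.sum_eq_sum_iff_of_le hle).mp (Equiv.sum_comp π fun x => x.val).symm
    ext x
    simpa using (this x (Finset.mem_univ x)).symm
  obtain ⟨hk, hlt⟩ := Nat.find_spec hex
  have hmin := fun k hk => Nat.find_min hex (m := k) hk
  generalize Nat.find hex = k at *
  obtain ⟨k, rfl⟩ : ∃ k', k = k' + 1 := ⟨k - 1, by omega⟩
  have hge : k ≤ (π ⟨k, by omega⟩).val := by
    by_contra hc
    exact hmin k (by omega) ⟨by omega, by omega⟩
  have e1 := h ⟨k, by omega⟩
  have e2 := h ⟨k + 1, hk⟩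
  simp only at e1 e2
  obtain ⟨p, -, hp, hpk⟩ := exists_letter_of_letterCount_eq_succ a ⟨k + 1, hk⟩
    (k := letterCount a ⟨k + 1, hk⟩ n - 1) le_rfl (by omega)
  obtain ⟨t, ht, htl⟩ := exists_letterCount_eq c ⟨k, by omega⟩
    (l := letterCount a ⟨k, by omega⟩ p) le_rfl
    ((letterCount_mono a _ p.2.le).trans (by omega))
  refine ⟨p, t, ⟨k, by omega⟩, by rw [hp], ht, htl, ?_⟩
  rw [hp, hpk]
  have := letterCount_mono c ⟨k + 1, hk⟩ ht
  omega

lemma contentRel_one : ContentRel a c 1 ↔ ∀ x, letterCount c x n = letterCount a x n :=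
  forall_congr' fun x => by simp

end ContentRel

/-- Exchange the tails of both words at the first ballot failure, if there is one. -/
def flipFirst {n m : ℕ} (T : (Fin n → Fin m) × (Fin n → Fin m) × Equiv.Perm (Fin m)) :
    (Fin n → Fin m) × (Fin n → Fin m) × Equiv.Perm (Fin m) :=
  if h : ∃ s : Fin n × ℕ × Fin m, FirstFailure T.1 T.2.1 s.1 s.2.1 s.2.2 then
    (flipTail h.choose.2.2 (T.1 h.choose.1) (h.choose.1 + 1) T.1,
      flipTail h.choose.2.2 (T.1 h.choose.1) h.choose.2.1 T.2.1,
      T.2.2 * Equiv.swap h.choose.2.2 (T.1 h.choose.1))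
  else T

lemma FirstFailure.flipFirst_eq {n m : ℕ} {a c : Fin n → Fin m} {p : Fin n} {t : ℕ} {i : Fin m}
    (h : FirstFailure a c p t i) (π : Equiv.Perm (Fin m)) :
    flipFirst (a, c, π) = (_root_.flipTail i (a p) (p + 1) a, _root_.flipTail i (a p) t c,
      π * Equiv.swap i (a p)) := by
  have hex : ∃ s : Fin n × ℕ × Fin m, FirstFailure a c s.1 s.2.1 s.2.2 := ⟨(p, t, i), h⟩
  obtain ⟨hp, ht, hi⟩ := h.unique hex.choose_spec
  rw [flipFirst, dif_pos hex, ← hp, ← ht, ← hi]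

/-- The content-compatible pairs of words without ballot failures are counted, with signs, by all
triples in `ContentRel`. -/
lemma sum_sign_contentRel (n m : ℕ) :
    ∑ T ∈ Finset.univ.filter
        (fun T : (Fin n → Fin m) × (Fin n → Fin m) × Equiv.Perm (Fin m) =>
          ContentRel T.1 T.2.1 T.2.2), ((Equiv.Perm.sign T.2.2 : ℤ) : ℚ) =
      (Finset.univ.filter fun P : (Fin n → Fin m) × (Fin n → Fin m) =>
        (∀ x, letterCount P.2 x n = letterCount P.1 x n) ∧
          ∀ p t i, ¬ BallotFailure P.1 P.2 p t i).card := by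
  rw [← Finset.sum_filter_add_sum_filter_not _
    (fun T => ∃ p t i, FirstFailure T.1 T.2.1 p t i)]
  rw [Finset.sum_involution (fun T _ => flipFirst T), zero_add]
  · rw [Finset.card_eq_sum_ones, Nat.cast_sum]
    symm
    refine Finset.sum_bij (fun P _ => (P.1, P.2, 1)) ?_ ?_ ?_ ?_
    · rintro ⟨a, c⟩ hP
      simp only [Finset.mem_filter, Finset.mem_univ, true_and] at hP ⊢
      exact ⟨contentRel_one.mpr hP.1, fun ⟨p, t, i, hf⟩ => hP.2 p t i hf.1⟩
    · rintro ⟨a, c⟩ - ⟨a', c'⟩ - h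
      simpa using h
    · rintro ⟨a, c, π⟩ hT
      simp only [Finset.mem_filter, Finset.mem_univ, true_and] at hT
      have hno : ∀ p t i, ¬ BallotFailure a c p t i :=
        fun p t i hf => hT.2 hf.exists_firstFailure
      have hπ : π = 1 := by
        by_contra hπ
        obtain ⟨p, t, i, hf⟩ := hT.1.exists_ballotFailure hπ
        exact hno p t i hf
      subst hπ
      exact ⟨(a, c), by simpa using ⟨contentRel_one.mp hT.1, hno⟩, rfl⟩
    · intros; simp
  all_goals
    rintro ⟨a, c, π⟩ hT
    simp only [Finset.mem_filter, Finset.mem_univ, true_and] at hT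
    obtain ⟨hrel, p, t, i, hf⟩ := hT
    have hne : i ≠ a p := fun e => by have := hf.1.1; rw [← e] at this; omega
    rw [hf.flipFirst_eq]
  · simp [Equiv.Perm.sign_swap hne]
  · intro _ e
    have e' : π * Equiv.swap i (a p) = π := congrArg (fun T => T.2.2) e
    rw [mul_eq_left, Equiv.swap_eq_one_iff] at e'
    exact hne e'
  · simp only [Finset.mem_filter, Finset.mem_univ, true_and]
    exact ⟨hrel.flipTail hf, p, t, i, hf.flipTail⟩
  · rw [hf.flipTail.flipFirst_eq, flipTail_apply_of_lt i (a p) _ a (Nat.lt_succ_self p.val),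
      flipTail_flipTail, flipTail_flipTail, mul_assoc, Equiv.swap_mul_self, mul_one]

/-- The colouring `a` is monotone for `σ` on colour classes, and every point of positive colour is
the lower end of an inversion of `σ` whose upper end has the preceding colour. -/
def GreedyColoring {n m : ℕ} (σ : Equiv.Perm (Fin n)) (a : Fin n → Fin m) : Prop :=
  (∀ p q, a p = a q → p < q → σ p < σ q) ∧
    ∀ p (i : Fin m), i.val + 1 = (a p).val → ∃ p' < p, a p' = i ∧ σ p < σ p'

section GreedyColoring

variable {n m : ℕ} {σ : Equiv.Perm (Fin n)} {a c : Fin n → Fin m}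

lemma letterCount_eq_card_of_comp (hc : ∀ p, c (σ p) = a p) (x : Fin m) (t : ℕ) :
    letterCount c x t =
      (Finset.univ.filter fun q : Fin n => (σ q).val < t ∧ a q = x).card := by
  rw [letterCount, ← Finset.card_map (f := σ.toEmbedding)
    (s := Finset.univ.filter fun q : Fin n => (σ q).val < t ∧ a q = x)]
  congr 1
  ext q
  simp only [Finset.mem_filter, Finset.mem_univ, true_and, Finset.mem_map_equiv]
  rw [← hc]
  simp

lemma letterCount_perm_apply (hc : ∀ p, c (σ p) = a p)
    (hσ : ∀ p q, a p = a q → p < q → σ p < σ q) (p : Fin n) :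
    letterCount c (a p) (σ p) = letterCount a (a p) p := by
  rw [letterCount_eq_card_of_comp hc, letterCount]
  congr 1
  ext q
  simp only [Finset.mem_filter, Finset.mem_univ, true_and, Fin.val_fin_lt]
  refine and_congr_left fun hq => ⟨fun h => ?_, fun h => hσ q p hq h⟩
  by_contra hpq
  rcases (not_lt.mp hpq).eq_or_lt with e | e
  · rw [e] at h; exact lt_irrefl _ h
  · exact lt_asymm h (hσ p q hq.symm e)

lemma not_ballotFailure_iff (hc : ∀ p, c (σ p) = a p)
    (hσ : ∀ p q, a p = a q → p < q → σ p < σ q) (p : Fin n) (i : Fin m)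
    (hi : i.val + 1 = (a p).val) :
    (∀ t, ¬ BallotFailure a c p t i) ↔ ∃ p' < p, a p' = i ∧ σ p < σ p' := by
  have hcp := letterCount_perm_apply hc hσ p
  have hci := letterCount_eq_card_of_comp hc i (σ p)
  constructor
  · intro h
    by_contra hno
    push Not at hno
    have hle : letterCount a i p ≤ letterCount c i (σ p) := by
      rw [hci]
      apply Finset.card_le_card
      intro q
      simp only [Finset.mem_filter, Finset.mem_univ, true_and, Fin.val_fin_lt]
      rintro ⟨h1, h2⟩
      exact ⟨lt_of_le_of_ne (hno q h1 h2) fun e => h1.ne (σ.injective e), h2⟩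
    obtain ⟨t, ht, htl⟩ := exists_letterCount_eq c i (σ p).2.le hle
    exact h t ⟨hi, ht.trans (σ p).2.le, htl, (letterCount_mono c _ ht).trans hcp.le⟩
  · rintro ⟨p', hp', hap', hσp'⟩ t ⟨-, ht, h1, h2⟩
    have htp : t ≤ σ p := by
      by_contra hlt
      have := letterCount_lt c (a p) (not_le.mp hlt) (hc p)
      omega
    have h3 := letterCount_mono c i htp
    rw [h1, hci] at h3
    refine absurd h3 (not_le.mpr (Finset.card_lt_card ?_))
    refine Finset.ssubset_iff_subset_ne.mpr ⟨?_, ?_⟩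
    · intro q
      simp only [Finset.mem_filter, Finset.mem_univ, true_and, Fin.val_fin_lt]
      rintro ⟨h4, h5⟩
      refine ⟨lt_of_lt_of_le (lt_of_not_ge fun hq => ?_) hp'.le, h5⟩
      rcases hq.eq_or_lt with e | e
      · rw [← e] at h4; exact lt_asymm h4 hσp'
      · exact lt_asymm (h4.trans hσp') (hσ p' q (hap'.trans h5.symm) e)
    · intro e
      have : p' ∈ Finset.univ.filter fun q : Fin n => q.val < p.val ∧ a q = i := by
        simpa using ⟨hp', hap'⟩
      rw [letterCount, ← e] at *
      simp only [Finset.mem_filter, Finset.mem_univ, true_and, Fin.val_fin_lt] at this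
      exact lt_asymm this.1 hσp'

lemma GreedyColoring.exists_ancestor (h : GreedyColoring σ a) (p : Fin n) (x : Fin m)
    (hx : x ≤ a p) : ∃ p' ≤ p, a p' = x ∧ σ p ≤ σ p' := by
  induction p using WellFoundedLT.induction with
  | ind p ih =>
    rcases hx.eq_or_lt with e | e
    · exact ⟨p, le_rfl, e.symm, le_rfl⟩
    · have e' : x.val < (a p).val := e
      obtain ⟨p', h1, h2, h3⟩ := h.2 p ⟨(a p).val - 1, by omega⟩ (by simp only; omega)
      obtain ⟨p'', h4, h5, h6⟩ := ih p' h1 (by rw [h2, Fin.le_def]; simp only; omega)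
      exact ⟨p'', h4.trans h1.le, h5, h3.le.trans h6⟩

lemma GreedyColoring.lt_of_inversion (h : GreedyColoring σ a) {p q : Fin n} (hpq : p < q)
    (hσ : σ q < σ p) : a p < a q := by
  by_contra hle
  obtain ⟨p', h1, h2, h3⟩ := h.exists_ancestor p (a q) (not_lt.mp hle)
  exact lt_asymm (hσ.trans_le h3) (h.1 p' q h2 (h1.trans_lt hpq))

lemma GreedyColoring.le {a' : Fin n → Fin m} (h : GreedyColoring σ a)
    (h' : GreedyColoring σ a') (p : Fin n) : (a p).val ≤ (a' p).val := by
  induction p using WellFoundedLT.induction with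
  | ind p ih =>
    rcases Nat.eq_zero_or_pos (a p).val with e | e
    · omega
    · obtain ⟨p', h1, h2, h3⟩ := h.2 p ⟨(a p).val - 1, by omega⟩ (by simp only; omega)
      have h4 : (a' p').val < (a' p).val := h'.lt_of_inversion h1 h3
      have h5 := ih p' h1
      rw [h2] at h5
      simp only at h5
      omega

lemma GreedyColoring.unique {a' : Fin n → Fin m} (h : GreedyColoring σ a)
    (h' : GreedyColoring σ a') : a = a' :=
  funext fun p => Fin.ext (le_antisymm (h.le h' p) (h'.le h p))

/-- `p` ends a chain of `k` successive inversions of `σ`. -/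
def EndsInversionChain {n : ℕ} (σ : Equiv.Perm (Fin n)) : ℕ → Fin n → Prop
  | 0, _ => True
  | k + 1, q => ∃ p < q, σ q < σ p ∧ EndsInversionChain σ k p

lemma strictMono_snoc {k : ℕ} {s : Fin (k + 1) → Fin n} {p : Fin n} (hs : StrictMono s)
    (hp : s (Fin.last k) < p) : StrictMono (Fin.snoc (α := fun _ => Fin n) s p) := by
  rw [Fin.strictMono_iff_lt_succ]
  intro i
  induction i using Fin.lastCases with
  | last => simpa using hp
  | cast i =>
    rw [Fin.succ_castSucc, Fin.snoc_castSucc, Fin.snoc_castSucc]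
    exact hs i.castSucc_lt_succ

lemma EndsInversionChain.exists_strictMono {k : ℕ} {p : Fin n} (h : EndsInversionChain σ k p) :
    ∃ s : Fin (k + 1) → Fin n, StrictMono s ∧ (StrictMono fun b => Fin.rev (σ (s b))) ∧
      s (Fin.last k) = p := by
  induction k generalizing p with
  | zero =>
    exact ⟨fun _ => p, fun x y h => by omega, fun x y h => by omega, rfl⟩
  | succ k ih =>
    obtain ⟨q, hq, hσ, hk⟩ := h
    obtain ⟨s, h1, h2, h3⟩ := ih hk
    refine ⟨Fin.snoc (α := fun _ => Fin n) s p, ?_, ?_, by simp⟩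
    · exact strictMono_snoc h1 (by rwa [h3])
    · have h4 := strictMono_snoc (p := Fin.rev (σ p)) h2 (by simpa [h3] using hσ)
      convert h4 using 1
      ext1 b
      induction b using Fin.lastCases with
      | last => simp
      | cast b => simp

lemma exists_greedyColoring_iff :
    (∃ a : Fin n → Fin m, GreedyColoring σ a) ↔
      ¬ HasAscSeq (⇑(σ.trans Fin.revPerm)) (m + 1) := by
  constructor
  · rintro ⟨a, ha⟩ ⟨s, h1, h2⟩
    have h3 : StrictMono (a ∘ s) := fun x y hxy =>
      ha.lt_of_inversion (h1 hxy) (by simpa using h2 hxy)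
    simpa using Fintype.card_le_of_injective _ h3.injective
  · intro h
    have hlt : ∀ k p, EndsInversionChain σ k p → k < m := by
      intro k p hk
      by_contra hkm
      obtain ⟨s, h1, h2, -⟩ := hk.exists_strictMono
      have hemb : StrictMono (Fin.castLE (show m + 1 ≤ k + 1 by omega)) := Fin.strictMono_castLE _
      exact h ⟨s ∘ Fin.castLE (by omega), h1.comp hemb, h2.comp hemb⟩
    let d : Fin n → ℕ := fun p => Nat.findGreatest (fun k => EndsInversionChain σ k p) m
    have hd : ∀ p, EndsInversionChain σ (d p) p := fun p =>
      Nat.findGreatest_spec (P := fun k => EndsInversionChain σ k p) (Nat.zero_le m) trivial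
    have hmax : ∀ k p, EndsInversionChain σ k p → k ≤ d p := fun k p hk =>
      Nat.le_findGreatest (hlt k p hk).le hk
    have hinv : ∀ p q, p < q → σ q < σ p → d p < d q := fun p q hpq hσ =>
      hmax (d p + 1) q ⟨p, hpq, hσ, hd p⟩
    refine ⟨fun p => ⟨d p, hlt _ p (hd p)⟩, fun p q he hpq => ?_, fun p i hi => ?_⟩
    · by_contra hle
      have h4 : σ q < σ p := lt_of_le_of_ne (not_lt.mp hle) fun e => hpq.ne' (σ.injective e)
      exact (hinv p q hpq h4).ne (Fin.ext_iff.mp he)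
    · have h5 := hd p
      simp only at hi
      rw [← hi] at h5
      obtain ⟨p', h6, h7, h8⟩ := h5
      refine ⟨p', h6, Fin.ext ?_, h7⟩
      have h9 := hmax _ _ h8
      have h10 := hinv p' p h6 h7
      simp only
      omega

lemma exists_perm_of_letterCount_eq (h : ∀ x, letterCount c x n = letterCount a x n) :
    ∃ σ : Equiv.Perm (Fin n), (∀ p, c (σ p) = a p) ∧ ∀ p q, a p = a q → p < q → σ p < σ q := by
  have hcard : ∀ x, Fintype.card {p // a p = x} = Fintype.card {q // c q = x} := by
    intro x
    simpa [letterCount, Fintype.card_subtype] using (h x).symm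
  let e : ∀ x, {p // a p = x} ≃o {q // c q = x} := fun x =>
    (Fintype.orderIsoFinOfCardEq _ rfl).symm.trans
      (Fintype.orderIsoFinOfCardEq _ (hcard x).symm)
  let σ : Equiv.Perm (Fin n) := (Equiv.sigmaFiberEquiv a).symm.trans
    ((Equiv.sigmaCongrRight fun x => (e x).toEquiv).trans (Equiv.sigmaFiberEquiv c))
  have hσ : ∀ p x (hx : a p = x), σ p = (e x ⟨p, hx⟩).1 := by
    rintro p x rfl
    rfl
  refine ⟨σ, fun p => ?_, fun p q hpq hlt => ?_⟩
  · rw [hσ p _ rfl]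
    exact (e (a p) ⟨p, rfl⟩).2
  · rw [hσ p _ hpq, hσ q _ rfl]
    exact (e (a q)).strictMono (show (⟨p, hpq⟩ : {r // a r = a q}) < ⟨q, rfl⟩ from hlt)

lemma perm_eq_of_comp_eq {σ' : Equiv.Perm (Fin n)} (hc : ∀ p, c (σ p) = a p)
    (hc' : ∀ p, c (σ' p) = a p) (hσ : ∀ p q, a p = a q → p < q → σ p < σ q)
    (hσ' : ∀ p q, a p = a q → p < q → σ' p < σ' q) : σ = σ' := by
  ext1 p
  have h1 := letterCount_perm_apply hc hσ p
  have h2 := letterCount_perm_apply hc' hσ' p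
  rcases lt_trichotomy (σ p) (σ' p) with h | h | h
  · have := letterCount_lt c (a p) (Fin.lt_def.mp h) (hc p)
    omega
  · exact h
  · have := letterCount_lt c (a p) (Fin.lt_def.mp h) (hc' p)
    omega

end GreedyColoring

lemma permCount_eq_card (m n : ℕ) :
    permCount m n = (Finset.univ.filter fun P : (Fin n → Fin m) × (Fin n → Fin m) =>
        (∀ x, letterCount P.2 x n = letterCount P.1 x n) ∧
          ∀ p t i, ¬ BallotFailure P.1 P.2 p t i).card := by
  have h1 : permCount m n =
      Nat.card {σ : Equiv.Perm (Fin n) // ∃ a : Fin n → Fin m, GreedyColoring σ a} := by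
    refine (Nat.card_congr (Equiv.subtypeEquiv
      (Equiv.mulLeft (Fin.revPerm : Equiv.Perm (Fin n))) fun σ => ?_)).symm
    exact exists_greedyColoring_iff
  rw [h1, Nat.card_eq_fintype_card, ← Finset.card_univ]
  have hgood : ∀ (σ : Equiv.Perm (Fin n)) (a c : Fin n → Fin m), (∀ p, c (σ p) = a p) →
      (∀ p q, a p = a q → p < q → σ p < σ q) →
      (GreedyColoring σ a ↔ ∀ p t i, ¬ BallotFailure a c p t i) := by
    intro σ a c hc hσ
    constructor
    · intro h p t i hf
      exact (not_ballotFailure_iff hc hσ p i hf.1).mpr (h.2 p i hf.1) t hf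
    · exact fun h => ⟨hσ, fun p i hi =>
        (not_ballotFailure_iff hc hσ p i hi).mp fun t => h p t i⟩
  refine Finset.card_bij (fun σ _ => (σ.2.choose, σ.2.choose ∘ σ.1.symm)) ?_ ?_ ?_
  · rintro ⟨σ, hσ⟩ -
    simp only [Finset.mem_filter, Finset.mem_univ, true_and]
    have hg := hσ.choose_spec
    refine ⟨fun x => ?_, (hgood σ _ _ (by simp) hg.1).mp hg⟩
    rw [letterCount_eq_card_of_comp (σ := σ) (a := hσ.choose) (by simp)]
    simp [letterCount]
  · rintro ⟨σ, hσ⟩ - ⟨σ', hσ'⟩ - h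
    simp only [Prod.mk.injEq] at h
    obtain ⟨ha, hc⟩ := h
    have hg := hσ.choose_spec
    have hg' := hσ'.choose_spec
    generalize hσ.choose = a at *
    generalize hσ'.choose = a' at *
    subst ha
    refine Subtype.ext (perm_eq_of_comp_eq (a := a) (c := a ∘ σ.symm) (by simp) ?_ hg.1 hg'.1)
    rw [hc]
    simp
  · rintro ⟨a, c⟩ hP
    simp only [Finset.mem_filter, Finset.mem_univ, true_and] at hP
    obtain ⟨σ, hc, hσ⟩ := exists_perm_of_letterCount_eq hP.1
    have hg := (hgood σ a c hc hσ).mpr hP.2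
    refine ⟨⟨σ, a, hg⟩, Finset.mem_univ _, ?_⟩
    have ha : (⟨a, hg⟩ : ∃ a, GreedyColoring σ a).choose = a :=
      GreedyColoring.unique (Exists.choose_spec _) hg
    simp only [ha, Prod.mk.injEq, true_and]
    ext1 q
    rw [Function.comp_apply, ← hc, Equiv.apply_symm_apply]

section Counting

lemma letterCount_eq_sum {n m : ℕ} (f : Fin n → Fin m) (x : Fin m) :
    letterCount f x n = ∑ q, if f q = x then 1 else 0 := by
  simp [letterCount]

lemma letterCount_cons {n m : ℕ} (y : Fin m) (w : Fin n → Fin m) (x : Fin m) :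
    letterCount (Fin.cons y w : Fin (n + 1) → Fin m) x (n + 1) =
      (if y = x then 1 else 0) + letterCount w x n := by
  rw [letterCount_eq_sum, letterCount_eq_sum, Fin.sum_univ_succ]
  simp

/-- The number of words with prescribed content is a multinomial coefficient. -/
lemma card_words_mul_prod_factorial {n m : ℕ} (b : Fin m → ℕ) (hb : ∑ x, b x = n) :
    (Finset.univ.filter fun c : Fin n → Fin m => ∀ x, letterCount c x n = b x).card *
      ∏ x, (b x).factorial = n.factorial := by
  induction n generalizing b with
  | zero =>
    have h0 : ∀ x, b x = 0 := by simpa using hb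
    have : ∀ c : Fin 0 → Fin m, ∀ x, letterCount c x 0 = b x := fun c x => by
      rw [letterCount_zero, h0]
    rw [Finset.filter_true_of_mem fun c _ => this c]
    simp [h0]
  | succ n ih =>
    have hstep : (Finset.univ.filter fun c : Fin (n + 1) → Fin m =>
        ∀ x, letterCount c x (n + 1) = b x).card = ∑ y, (Finset.univ.filter fun w : Fin n → Fin m =>
          ∀ x, (if y = x then 1 else 0) + letterCount w x n = b x).card := by
      simp only [Finset.card_filter]
      rw [← (Fin.consEquiv fun _ => Fin m).sum_comp, Fintype.sum_prod_type]
      refine Finset.sum_congr rfl fun y _ => Finset.sum_congr rfl fun w _ => ?_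
      have h : ∀ x, letterCount (Fin.consEquiv (fun _ => Fin m) (y, w)) x (n + 1) =
          (if y = x then 1 else 0) + letterCount w x n := letterCount_cons y w
      simp only [h]
    rw [hstep, Finset.sum_mul, Nat.factorial_succ, ← hb, Finset.sum_mul]
    refine Finset.sum_congr rfl fun y _ => ?_
    rcases Nat.eq_zero_or_pos (b y) with h0 | hpos
    · rw [Finset.filter_false_of_mem, Finset.card_empty, h0, zero_mul, zero_mul]
      intro w _ h
      have := h y
      rw [if_pos rfl] at this
      omega
    · let b' := Function.update b y (b y - 1)
      have hby : b' y + 1 = b y := by simp only [b', Function.update_self]; omega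
      have hne : ∀ x, x ≠ y → b' x = b x := fun x hx => Function.update_of_ne hx _ _
      have hiff : ∀ w : Fin n → Fin m, (∀ x, (if y = x then 1 else 0) + letterCount w x n = b x) ↔
          ∀ x, letterCount w x n = b' x := fun w => forall_congr' fun x => by
        split_ifs with hx
        · subst hx; omega
        · rw [hne x (Ne.symm hx), zero_add]
      simp only [hiff]
      have hsum : ∑ x, b' x = n := by
        have h1 := Finset.add_sum_erase _ (fun x => b x) (Finset.mem_univ y)
        have h2 := Finset.add_sum_erase _ (fun x => b' x) (Finset.mem_univ y)
        have h3 : ∑ x ∈ Finset.univ.erase y, b' x = ∑ x ∈ Finset.univ.erase y, b x :=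
          Finset.sum_congr rfl fun x hx => hne x (Finset.ne_of_mem_erase hx)
        omega
      have hprod : ∏ x, (b x).factorial = b y * ∏ x, (b' x).factorial := by
        rw [← Finset.mul_prod_erase _ _ (Finset.mem_univ y),
          ← Finset.mul_prod_erase _ (fun x => (b' x).factorial) (Finset.mem_univ y),
          Finset.prod_congr rfl fun x hx => by rw [← hne x (Finset.ne_of_mem_erase hx)],
          ← hby, Nat.factorial_succ, mul_assoc]
      rw [hprod, mul_left_comm, ih b' hsum]

lemma card_contentRel {n m : ℕ} (a : Fin n → Fin m) (π : Equiv.Perm (Fin m)) :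
    ((Finset.univ.filter fun c : Fin n → Fin m => ContentRel a c π).card : ℚ) =
      n.factorial * ∏ x : Fin m,
        (((letterCount a x n + (m - 1 - x.val)).descFactorial (Fin.rev (π x)).val : ℕ) : ℚ) /
          (letterCount a x n + (m - 1 - x.val)).factorial := by
  by_cases h : ∀ x : Fin m, x.val ≤ letterCount a x n + (π x).val
  · let b : Fin m → ℕ := fun x => letterCount a x n + (π x).val - x.val
    have hb : ∀ x, b x + x.val = letterCount a x n + (π x).val := fun x => Nat.sub_add_cancel (h x)
    have hsum : ∑ x, b x = n := by
      have h1 := Finset.sum_congr rfl fun x (_ : x ∈ Finset.univ) => hb x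
      rw [Finset.sum_add_distrib, Finset.sum_add_distrib, sum_letterCount,
        Equiv.sum_comp π fun x => x.val] at h1
      omega
    have hiff : ∀ c, ContentRel a c π ↔ ∀ x, letterCount c x n = b x := fun c =>
      forall_congr' fun x => by have := hb x; omega
    simp only [hiff]
    have hterm : ∀ x : Fin m,
        (((letterCount a x n + (m - 1 - x.val)).descFactorial (Fin.rev (π x)).val : ℕ) : ℚ) /
          (letterCount a x n + (m - 1 - x.val)).factorial = ((b x).factorial : ℚ)⁻¹ := by
      intro x
      have h1 := hb x
      have h2 := x.2
      have h3 := (π x).2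
      have h4 : (Fin.rev (π x)).val = m - ((π x).val + 1) := Fin.val_rev _
      have h5 := Nat.factorial_mul_descFactorial
        (show (Fin.rev (π x)).val ≤ letterCount a x n + (m - 1 - x.val) by omega)
      rw [show letterCount a x n + (m - 1 - x.val) - (Fin.rev (π x)).val = b x by omega] at h5
      rw [← h5]
      have h6 : (((letterCount a x n + (m - 1 - x.val)).descFactorial
          (Fin.rev (π x)).val : ℕ) : ℚ) ≠ 0 := by
        rw [Nat.cast_ne_zero, Ne, Nat.descFactorial_eq_zero_iff_lt]
        omega
      have h7 : ((b x).factorial : ℚ) ≠ 0 := Nat.cast_ne_zero.mpr (Nat.factorial_ne_zero _)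
      push_cast
      field_simp
    rw [Finset.prod_congr rfl fun x _ => hterm x, ← card_words_mul_prod_factorial b hsum,
      Finset.prod_inv_distrib]
    push_cast
    rw [mul_assoc, mul_inv_cancel₀, mul_one]
    exact Finset.prod_ne_zero_iff.mpr fun x _ => Nat.cast_ne_zero.mpr (Nat.factorial_ne_zero _)
  · push Not at h
    obtain ⟨x, hx⟩ := h
    rw [Finset.filter_false_of_mem fun c _ hc => by have := hc x; omega,
      Finset.prod_eq_zero (Finset.mem_univ x)]
    · simp
    · have h2 := x.2
      have h3 := (π x).2
      have h4 : (Fin.rev (π x)).val = m - ((π x).val + 1) := Fin.val_rev _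
      rw [Nat.descFactorial_of_lt (by omega)]
      simp

lemma sum_sign_prod_descFactorial {m : ℕ} (l : Fin m → ℕ) :
    ∑ π : Equiv.Perm (Fin m), ((Equiv.Perm.sign π : ℤ) : ℚ) *
        ∏ x, (((l x).descFactorial (Fin.rev (π x)).val : ℕ) : ℚ) =
      ∏ p ∈ Finset.univ.filter fun p : Fin m × Fin m => p.1 < p.2, ((l p.1 : ℚ) - l p.2) := by
  let N : Matrix (Fin m) (Fin m) ℚ :=
    Matrix.of fun x y => (descPochhammer ℚ y.val).eval (l (Fin.rev x) : ℚ)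
  have hN : N.det = (Matrix.vandermonde fun x => (l (Fin.rev x) : ℚ)).det :=
    (Matrix.det_eval_matrixOfPolynomials_eq_det_vandermonde _ (fun y => descPochhammer ℚ y.val)
      (fun y => descPochhammer_natDegree ℚ y.val) (fun y => monic_descPochhammer ℚ y.val)).symm
  have hL : ∑ π : Equiv.Perm (Fin m), ((Equiv.Perm.sign π : ℤ) : ℚ) *
        ∏ x, (((l x).descFactorial (Fin.rev (π x)).val : ℕ) : ℚ) =
      (N.submatrix Fin.revPerm Fin.revPerm).det := by
    rw [← Matrix.det_transpose, Matrix.det_apply']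
    simp [N, descPochhammer_eval_eq_descFactorial]
  rw [hL, Matrix.det_submatrix_equiv_self, hN, Matrix.det_vandermonde, Finset.prod_sigma']
  refine Finset.prod_bij' (fun p _ => (Fin.rev p.2, Fin.rev p.1))
    (fun p _ => ⟨Fin.rev p.2, Fin.rev p.1⟩) ?_ ?_ ?_ ?_ ?_
  · simp
  · simp
  · simp
  · simp
  · simp

lemma permCount_eq_sum_words (m n : ℕ) :
    (permCount m n : ℚ) = ∑ a : Fin n → Fin m, n.factorial *
      ((∏ p ∈ Finset.univ.filter fun p : Fin m × Fin m => p.1 < p.2,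
        (((letterCount a p.1 n + (m - 1 - p.1.val) : ℕ) : ℚ) -
          ((letterCount a p.2 n + (m - 1 - p.2.val) : ℕ) : ℚ))) /
        ∏ x : Fin m, ((letterCount a x n + (m - 1 - x.val)).factorial : ℚ)) := by
  rw [permCount_eq_card, ← sum_sign_contentRel, Finset.sum_filter, Fintype.sum_prod_type]
  refine Finset.sum_congr rfl fun a _ => ?_
  rw [Fintype.sum_prod_type_right,
    ← sum_sign_prod_descFactorial fun x => letterCount a x n + (m - 1 - x.val),
    Finset.sum_div, Finset.mul_sum]
  refine Finset.sum_congr rfl fun π _ => ?_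
  rw [← Finset.sum_filter]
  dsimp only
  rw [Finset.sum_const, nsmul_eq_mul, card_contentRel,
    Finset.prod_div_distrib]
  ring

end Counting

/-- `s_n^{(m)}/(n!)² = ∑_{b∈ℕ^m, ∑b=n} (∏_{i<j} (b_i−i−b_j+j)) / (∏_i b_i!(b_i−i+m)!)`.
Here indices `i,j` are 1-based in the informal statement; with 0-based indices
`i`, the factorial `(b_i−i+m)!` becomes `(b_i+(m−1−i))!` and the factor
`b_i−i−b_j+j` becomes `b_i−b_j−i+j`. -/
theorem permCount_div_factorial_sq (m : ℕ) (hm : 1 ≤ m) (n : ℕ) :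
    (permCount m n : ℚ) / (Nat.factorial n : ℚ) ^ 2 =
      ∑ b ∈ Finset.Nat.antidiagonalTuple m n,
        (∏ p ∈ Finset.univ.filter fun p : Fin m × Fin m => p.1 < p.2,
            ((b p.1 : ℚ) - ((p.1 : ℕ) : ℚ) - (b p.2 : ℚ) + ((p.2 : ℕ) : ℚ)))
          / (∏ i : Fin m,
              ((Nat.factorial (b i) : ℚ) *
                (Nat.factorial (b i + (m - 1 - (i : ℕ))) : ℚ))) := by
  have hn : (n.factorial : ℚ) ≠ 0 := Nat.cast_ne_zero.mpr (Nat.factorial_ne_zero _)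
  rw [div_eq_iff (pow_ne_zero 2 hn), permCount_eq_sum_words, Finset.sum_mul,
    ← Finset.sum_fiberwise_of_maps_to (s := Finset.univ)
      (t := Finset.Nat.antidiagonalTuple m n) (g := fun a x => letterCount a x n)
      fun a _ => Finset.Nat.mem_antidiagonalTuple.mpr (sum_letterCount a)]
  refine Finset.sum_congr rfl fun b hb => ?_
  rw [Finset.sum_congr rfl (g := fun _ => (n.factorial : ℚ) *
    ((∏ p ∈ Finset.univ.filter fun p : Fin m × Fin m => p.1 < p.2,
      ((b p.1 : ℚ) - ((p.1 : ℕ) : ℚ) - (b p.2 : ℚ) + ((p.2 : ℕ) : ℚ))) /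
      ∏ x : Fin m, ((b x + (m - 1 - x.val)).factorial : ℚ)))]
  · have hcard := card_words_mul_prod_factorial b (Finset.Nat.mem_antidiagonalTuple.mp hb)
    have hset : (Finset.univ.filter fun a : Fin n → Fin m => (fun x => letterCount a x n) = b) =
        Finset.univ.filter fun a : Fin n → Fin m => ∀ x, letterCount a x n = b x := by
      simp only [funext_iff]
    rw [Finset.sum_const, nsmul_eq_mul, hset, Finset.prod_mul_distrib]
    have hb0 : (∏ x, ((b x).factorial : ℚ)) ≠ 0 :=
      Finset.prod_ne_zero_iff.mpr fun x _ => Nat.cast_ne_zero.mpr (Nat.factorial_ne_zero _)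
    have hl0 : (∏ x : Fin m, ((b x + (m - 1 - x.val)).factorial : ℚ)) ≠ 0 :=
      Finset.prod_ne_zero_iff.mpr fun x _ => Nat.cast_ne_zero.mpr (Nat.factorial_ne_zero _)
    have hcard' := congrArg (Nat.cast : ℕ → ℚ) hcard
    push_cast at hcard'
    rw [pow_two, ← mul_assoc]
    nth_rw 3 [← hcard']
    field_simp
  · intro a ha
    have hab : ∀ x, letterCount a x n = b x := congrFun (Finset.mem_filter.mp ha).2
    simp only [hab]
    congr 2
    refine Finset.prod_congr rfl fun p _ => ?_
    rw [Nat.sub_sub, Nat.sub_sub, Nat.cast_add, Nat.cast_add,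
      Nat.cast_sub (by omega), Nat.cast_sub (by omega)]
    push_cast
    ring
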